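/- Let Q be a Markov kernel on ℝ^d satisfying the drift condition (A4) with constants c > 0, ρ ∈ (0,1), R > 0, K > 0, and let Ψ : ℝ^d × ℝ^ℓ → (0,∞) be measurable with sup_{x,y,x'} Ψ(x,y)/Ψ(x',y) ≤ 1+δ for some δ > 0. Then there exists a constant C < ∞ (one may take C = (1+δ)(ρ + K)) such that for every probability measure μ on ℝ^d, sup_y ∬ e^{c|x'|} Q̄^{y,μ}(x,dx') μ(dx) ≤ C ∫ e^{c|x|} μ(dx). -/

import Mathlib

open MeasureTheory ProbabilityTheory ENNReal

noncomputable section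

/-- The Euclidean state space `ℝ^d`. -/
abbrev St (d : ℕ) : Type := EuclideanSpace ℝ (Fin d)

/-- Exponential weight `e^{c‖x‖}` viewed in `ℝ≥0∞`. -/
def expW {d : ℕ} (c : ℝ) (x : St d) : ℝ≥0∞ := ENNReal.ofReal (Real.exp (c * ‖x‖))

/-- Drift condition (A4) for a kernel `Q`. -/
def DriftCond {d : ℕ} (Q : Kernel (St d) (St d)) (c ρ R K : ℝ) : Prop :=
  (∀ x : St d, R ≤ ‖x‖ →
      ∫⁻ x', expW c x' ∂(Q x) ≤ ENNReal.ofReal (ρ * Real.exp (c * ‖x‖))) ∧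
  (∀ x : St d, ‖x‖ ≤ R → ∫⁻ x', expW c x' ∂(Q x) ≤ ENNReal.ofReal K)

/-- One step of the non-normalized filter: prediction by `Q`, then weighting by `Ψ(·, y)`. -/
def step {d l : ℕ} (Q : Kernel (St d) (St d)) (Ψ : St d → St l → ℝ) (y : St l)
    (μ : Measure (St d)) : Measure (St d) :=
  (μ.bind fun x => Q x).withDensity fun x' => ENNReal.ofReal (Ψ x' y)

/-- Non-normalized filtering operator along a list of observations
(the observations are applied in chronological order). -/
def nnFilter {d l : ℕ} (Q : Kernel (St d) (St d)) (Ψ : St d → St l → ℝ)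
    (ys : List (St l)) (μ : Measure (St d)) : Measure (St d) :=
  ys.foldl (fun m y => step Q Ψ y m) μ

/-- Normalization of a measure. -/
def normalizeM {α : Type*} [MeasurableSpace α] (μ : Measure α) : Measure α :=
  (μ Set.univ)⁻¹ • μ

/-- Normalized filtering operator `μ S̄_{k:n}`. -/
def nFilter {d l : ℕ} (Q : Kernel (St d) (St d)) (Ψ : St d → St l → ℝ)
    (ys : List (St l)) (μ : Measure (St d)) : Measure (St d) :=
  normalizeM (nnFilter Q Ψ ys μ)

/-- One-step normalized update `μ ↦ μ Q̄^y`. -/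
def stepBar {d l : ℕ} (Q : Kernel (St d) (St d)) (Ψ : St d → St l → ℝ) (y : St l)
    (μ : Measure (St d)) : Measure (St d) :=
  normalizeM (step Q Ψ y μ)

/-- The conditional kernel `Q̄^{y,μ}(x, dx') = Q(x,dx') Ψ(x',y) / ∬ Q(x̃,dx₁) Ψ(x₁,y) μ(dx̃)`. -/
def condBar {d l : ℕ} (Q : Kernel (St d) (St d)) (Ψ : St d → St l → ℝ) (y : St l)
    (μ : Measure (St d)) (x : St d) : Measure (St d) :=
  (step Q Ψ y μ Set.univ)⁻¹ • ((Q x).withDensity fun x' => ENNReal.ofReal (Ψ x' y))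

/-- Total variation distance between two measures. -/
def tvDist {α : Type*} [MeasurableSpace α] (μ ν : Measure α) : ℝ≥0∞ :=
  ⨆ A : Set α, ((μ A - ν A) + (ν A - μ A))

/-- Birkhoff (Hilbert, projective) distance between two measures. -/
def birkhoffDist {α : Type*} [MeasurableSpace α] (μ ν : Measure α) : ℝ≥0∞ :=
  ⨅ (s : ℝ) (t : ℝ) (_ : 0 < t)
    (_ : ∀ A : Set α, μ A ≤ ENNReal.ofReal s * ν A)
    (_ : ∀ A : Set α, ENNReal.ofReal t * ν A ≤ μ A),
    ENNReal.ofReal (Real.log (s / t))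

/-- Expectation of a functional of the observations `Y_{1:n}` under the exact model
started from `μ₀`: the joint density of `Y_{1:n}` at `y` is the total mass of the
non-normalized filter. -/
def obsExp {d l : ℕ} (Q : Kernel (St d) (St d)) (Ψ : St d → St l → ℝ)
    (μ₀ : Measure (St d)) (n : ℕ) (f : (Fin n → St l) → ℝ≥0∞) : ℝ≥0∞ :=
  ∫⁻ y : Fin n → St l, f y * nnFilter Q Ψ (List.ofFn y) μ₀ Set.univ

/-- Law at time `n` of the homogeneous Markov chain with kernel `Q` started at `x`. -/
def chainLaw {d : ℕ} (Q : Kernel (St d) (St d)) (x : St d) : ℕ → Measure (St d)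
  | 0 => Measure.dirac x
  | n + 1 => (chainLaw Q x n).bind fun z => Q z

/-- `survLaw Q R x n` is the law at time `n` of the chain started at `x` and killed
when entering the closed ball of radius `R`; thus `survLaw Q R x n {z | R < ‖z‖}`
is the probability that the hitting time `τ̂_R` exceeds `n`. -/
def survLaw {d : ℕ} (Q : Kernel (St d) (St d)) (R : ℝ) (x : St d) : ℕ → Measure (St d)
  | 0 => Measure.dirac x
  | n + 1 => ((survLaw Q R x n).restrict {z | R < ‖z‖}).bind fun z => Q z

/-- `E_x exp(λ τ̂_R)`, via the identity `e^{λτ} = 1 + (e^λ - 1) ∑_{n<τ} e^{λn}`. -/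
def expHit {d : ℕ} (Q : Kernel (St d) (St d)) (R lam : ℝ) (x : St d) : ℝ≥0∞ :=
  1 + ENNReal.ofReal (Real.exp lam - 1) *
      ∑' n : ℕ, ENNReal.ofReal (Real.exp (lam * n)) * survLaw Q R x n {z | R < ‖z‖}

/-- Law at time `n` of the time-inhomogeneous Markov chain whose `i`-th step uses
the kernel `P i` (steps `1, …, n`), started at `x`. -/
def chainLawSeq {α : Type*} [MeasurableSpace α] (P : ℕ → Kernel α α) (x : α) :
    ℕ → Measure α
  | 0 => Measure.dirac x
  | n + 1 => (chainLawSeq P x n).bind fun z => P (n + 1) z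

/-- Composition of a list of (sub-)kernels given as measure-valued maps, applied at `x`. -/
def condComp {α : Type*} [MeasurableSpace α] (ks : List (α → Measure α)) (x : α) :
    Measure α :=
  ks.foldl (fun m k => m.bind k) (Measure.dirac x)

/-- The list of observations `y_{k+1}, …, y_n` (in chronological order). -/
def obsList {l : ℕ} (y : ℕ → St l) (k n : ℕ) : List (St l) :=
  (List.range (n - k)).map fun i => y (k + 1 + i)

/-- The wrong filter `μ'_k`, defined recursively by one-step normalized updates with the
wrong kernel `P` and wrong observation density `Ξ`. -/
def wrongFilter {d l : ℕ} (P : Kernel (St d) (St d)) (Ξ : St d → St l → ℝ)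
    (y : ℕ → St l) (μ₀ : Measure (St d)) : ℕ → Measure (St d)
  | 0 => μ₀
  | k + 1 => stepBar P Ξ (y (k + 1)) (wrongFilter P Ξ y μ₀ k)

end

lemma one_le_exp_mul_norm {d : ℕ} {c : ℝ} (hc : 0 ≤ c) (x : St d) :
    1 ≤ Real.exp (c * ‖x‖) :=
  Real.one_le_exp (by positivity)

lemma DriftCond.lintegral_expW_le {d : ℕ} {Q : Kernel (St d) (St d)} {c ρ R K : ℝ}
    (h : DriftCond Q c ρ R K) (hc : 0 ≤ c) (hρ : 0 ≤ ρ) (hK : 0 ≤ K) (x : St d) :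
    ∫⁻ x', expW c x' ∂(Q x) ≤ ENNReal.ofReal (ρ + K) * expW c x := by
  have hx := one_le_exp_mul_norm hc x
  rw [expW, ← ENNReal.ofReal_mul (by positivity)]
  rcases le_total R ‖x‖ with hR | hR
  · exact (h.1 x hR).trans (ENNReal.ofReal_le_ofReal (by nlinarith))
  · exact (h.2 x hR).trans (ENNReal.ofReal_le_ofReal (by nlinarith))

lemma ofReal_le_mul_step_univ {d l : ℕ} (Q : Kernel (St d) (St d)) [IsMarkovKernel Q]
    (Ψ : St d → St l → ℝ) {C : ℝ} (hC : 0 ≤ C) (y : St l)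
    (hΨ : ∀ x x' : St d, Ψ x y ≤ C * Ψ x' y)
    (μ : Measure (St d)) [IsProbabilityMeasure μ] (x : St d) :
    ENNReal.ofReal (Ψ x y) ≤ ENNReal.ofReal C * step Q Ψ y μ Set.univ := by
  rw [step, withDensity_apply _ MeasurableSet.univ, Measure.restrict_univ,
    ← lintegral_const_mul' _ _ ENNReal.ofReal_ne_top]
  have hP : IsProbabilityMeasure (μ.bind fun x => Q x) :=
    inferInstanceAs (IsProbabilityMeasure (μ.bind Q))
  calc ENNReal.ofReal (Ψ x y)
      = ∫⁻ _, ENNReal.ofReal (Ψ x y) ∂(μ.bind fun x => Q x) := by simp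
    _ ≤ _ := lintegral_mono fun x' => by
        rw [← ENNReal.ofReal_mul hC]
        exact ENNReal.ofReal_le_ofReal (hΨ x x')

lemma measurable_expW {d : ℕ} (c : ℝ) : Measurable (expW c : St d → ℝ≥0∞) := by
  unfold expW
  fun_prop

lemma lintegral_condBar_le {d l : ℕ} (Q : Kernel (St d) (St d)) [IsMarkovKernel Q]
    (Ψ : St d → St l → ℝ) {C : ℝ} (hC : 0 ≤ C) (y : St l)
    (hΨm : Measurable fun x => Ψ x y) (hΨ : ∀ x x' : St d, Ψ x y ≤ C * Ψ x' y)
    (μ : Measure (St d)) [IsProbabilityMeasure μ]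
    (f : St d → ℝ≥0∞) (hf : Measurable f) (x : St d)
    (h0 : step Q Ψ y μ Set.univ ≠ 0) (htop : step Q Ψ y μ Set.univ ≠ ⊤) :
    ∫⁻ x', f x' ∂(condBar Q Ψ y μ x) ≤ ENNReal.ofReal C * ∫⁻ x', f x' ∂(Q x) := by
  rw [condBar, lintegral_smul_measure,
    lintegral_withDensity_eq_lintegral_mul _ hΨm.ennreal_ofReal hf, smul_eq_mul]
  set Z := step Q Ψ y μ Set.univ with hZ
  calc Z⁻¹ * ∫⁻ x', ((fun x' => ENNReal.ofReal (Ψ x' y)) * f) x' ∂(Q x)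
      ≤ Z⁻¹ * ∫⁻ x', ENNReal.ofReal C * Z * f x' ∂(Q x) := by
        gcongr with x'
        exact mul_le_mul_left (ofReal_le_mul_step_univ Q Ψ hC y hΨ μ x') _
    _ = (Z⁻¹ * Z) * (ENNReal.ofReal C * ∫⁻ x', f x' ∂(Q x)) := by
        rw [lintegral_const_mul _ hf]
        ring
    _ = _ := by rw [ENNReal.inv_mul_cancel h0 htop, one_mul]

theorem condKernel_integrated_exp_moment {d l : ℕ}
    (Q : Kernel (St d) (St d)) [IsMarkovKernel Q]
    (c ρ R K : ℝ) (hc : 0 < c) (hρ : ρ ∈ Set.Ioo (0 : ℝ) 1) (hR : 0 < R) (hK : 0 < K)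
    (hA4 : DriftCond Q c ρ R K)
    (Ψ : St d → St l → ℝ) (hΨm : Measurable (Function.uncurry Ψ))
    (hΨpos : ∀ (x : St d) (y : St l), 0 < Ψ x y)
    (δ : ℝ) (hδ : 0 < δ)
    (hA5 : ∀ (x x' : St d) (y : St l), Ψ x y ≤ (1 + δ) * Ψ x' y)
    (μ : Measure (St d)) [IsProbabilityMeasure μ]
    (hden : ∀ y : St l, 0 < step Q Ψ y μ Set.univ ∧ step Q Ψ y μ Set.univ ≠ ⊤) :
    ∀ y : St l,
      ∫⁻ x, (∫⁻ x', expW c x' ∂(condBar Q Ψ y μ x)) ∂μ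
        ≤ ENNReal.ofReal ((1 + δ) * (ρ + K)) * ∫⁻ x, expW c x ∂μ := by
  intro y
  have hC : 0 ≤ 1 + δ := by positivity
  rw [← lintegral_const_mul _ (measurable_expW c)]
  refine lintegral_mono fun x => ?_
  calc ∫⁻ x', expW c x' ∂(condBar Q Ψ y μ x)
      ≤ ENNReal.ofReal (1 + δ) * ∫⁻ x', expW c x' ∂(Q x) :=
        lintegral_condBar_le Q Ψ hC y (hΨm.comp measurable_prodMk_right)
          (fun x x' => hA5 x x' y) μ _ (measurable_expW c) x (hden y).1.ne' (hden y).2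
    _ ≤ ENNReal.ofReal (1 + δ) * (ENNReal.ofReal (ρ + K) * expW c x) := by
        gcongr
        exact hA4.lintegral_expW_le hc.le hρ.1.le hK.le x
    _ = _ := by rw [ENNReal.ofReal_mul hC, mul_assoc]
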